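/- arXiv:1710.10292 — 8 statements merged into one kernel-verified Lean document; each statement's English description precedes it below -/
import Mathlib

section
/- If a VASS V has a non-negative cycle, then V is not terminating, i.e., V has an infinite trace. (Concretely, if the cycle has length l and m is the maximum absolute value of all update entries on the cycle, then V has an infinite trace starting from the state consisting of the cycle's start location and the valuation with every component equal to m·l.) -/
namespace VASSPaper

abbrev Val (n : ℕ) := Fin n → ℕ
abbrev Upd (n : ℕ) := Fin n → ℤ
abbrev Transition (n : ℕ) (L : Type) := L × Upd n × L

/-- A vector addition system with states: a finite set of locations and a finite
set of transitions between locations, labelled by integer update vectors. -/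
structure VASS (n : ℕ) (L : Type) where
  Locs : Finset L
  Trns : Finset (Transition n L)
  valid : ∀ t ∈ Trns, t.1 ∈ Locs ∧ t.2.2 ∈ Locs

variable {n : ℕ} {L : Type}

/-- A step of the VASS: the transition is in the system and the (non-negative)
valuation is updated by the update vector. -/
def Step (V : VASS n L) (s : L × Val n) (d : Upd n) (s' : L × Val n) : Prop :=
  (s.1, d, s'.1) ∈ V.Trns ∧ ∀ i, (s'.2 i : ℤ) = (s.2 i : ℤ) + d i

/-- An infinite trace. -/
def InfTrace (V : VASS n L) (ℓ : ℕ → L) (v : ℕ → Val n) (d : ℕ → Upd n) : Prop :=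
  ∀ i, Step V (ℓ i, v i) (d i) (ℓ (i + 1), v (i + 1))

/-- A finite trace of length `k`. -/
def FinTrace (V : VASS n L) (k : ℕ) (ℓ : ℕ → L) (v : ℕ → Val n) (d : ℕ → Upd n) : Prop :=
  ∀ i < k, Step V (ℓ i, v i) (d i) (ℓ (i + 1), v (i + 1))

/-- `V` is terminating if it has no infinite trace. -/
def Terminating (V : VASS n L) : Prop := ¬ ∃ ℓ v d, InfTrace V ℓ v d

/-- A path, given as a list of transitions of `V` with matching endpoints. -/
def IsPath (V : VASS n L) (π : List (Transition n L)) : Prop :=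
  (∀ t ∈ π, t ∈ V.Trns) ∧ π.Chain' (fun t₁ t₂ => t₁.2.2 = t₂.1)

/-- The value of a path: the sum of its update vectors. -/
def pathVal (π : List (Transition n L)) : Upd n := (π.map (fun t => t.2.1)).sum

/-- A cycle: a non-empty path whose start location equals its end location. -/
def IsCycle (V : VASS n L) (π : List (Transition n L)) : Prop :=
  IsPath V π ∧ π ≠ [] ∧ π.head?.map (fun t => t.1) = π.getLast?.map (fun t => t.2.2)

/-- A multi-cycle: a finite collection of cycles. -/
def IsMultiCycle (V : VASS n L) (M : List (List (Transition n L))) : Prop :=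
  ∀ C ∈ M, IsCycle V C

/-- The value of a multi-cycle: the sum of the values of its cycles. -/
def multiVal (M : List (List (Transition n L))) : Upd n := (M.map pathVal).sum

/-- A state is `N`-bounded if each component of its valuation is at most `N`. -/
def NBounded (V : VASS n L) (N : ℕ) (s : L × Val n) : Prop :=
  s.1 ∈ V.Locs ∧ ∀ i, s.2 i ≤ N

/-- `s'` is reachable from `s` by a finite trace. -/
def ReachableFrom (V : VASS n L) (s s' : L × Val n) : Prop :=
  ∃ k ℓ v d, FinTrace V k ℓ v d ∧ (ℓ 0, v 0) = s ∧ (ℓ k, v k) = s'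

/-- The computational complexity: the length of the longest trace starting in an
`N`-bounded state. -/
noncomputable def compN (V : VASS n L) (N : ℕ) : ℕ :=
  sSup { k | ∃ ℓ v d, NBounded V N (ℓ 0, v 0) ∧ FinTrace V k ℓ v d }

/-- A quasi-ranking function: weakly decreasing along every step. -/
def QuasiRanking (V : VASS n L) (q : L × Val n → ℕ) : Prop :=
  ∀ s d s', Step V s d s' → q s' ≤ q s

/-- `q` is ranking for transition `t`: strictly decreasing along every step taken
along `t`. -/
def RankingFor (V : VASS n L) (q : L × Val n → ℕ) (t : Transition n L) : Prop :=
  ∀ s d s', Step V s d s' → (s.1, d, s'.1) = t → q s' < q s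

/-- The (strict) lexicographic order on finite sequences of naturals, as in the paper:
`x >lex y` iff there is an index (within both sequences) where `x` is larger and all
earlier entries agree. -/
def LexGt (x y : List ℕ) : Prop :=
  ∃ i, i < x.length ∧ i < y.length ∧ y.getD i 0 < x.getD i 0 ∧
    ∀ j < i, x.getD j 0 = y.getD j 0

/-- A lexicographic ranking function of order `k` for `V`. -/
def IsLexRankingOfOrder (V : VASS n L) (k : ℕ) (f : L × Val n → List ℕ) : Prop :=
  (∀ s : L × Val n, s.1 ∈ V.Locs → (f s).length ≤ k) ∧
  ∀ s d s', Step V s d s' → LexGt (f s) (f s')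

def SubVASS (S V : VASS n L) : Prop := S.Locs ⊆ V.Locs ∧ S.Trns ⊆ V.Trns

/-- There is a path (possibly empty) from `l` to `l'`. -/
def Reaches (V : VASS n L) (l l' : L) : Prop :=
  Relation.ReflTransGen (fun a b => ∃ d, (a, d, b) ∈ V.Trns) l l'

/-- `V` is connected: every location can reach every other location. -/
def ConnectedV (V : VASS n L) : Prop :=
  ∀ l ∈ V.Locs, ∀ l' ∈ V.Locs, Reaches V l l'

/-- A strongly connected component: a maximal connected sub-VASS. -/
def IsSCC (V S : VASS n L) : Prop :=
  SubVASS S V ∧ ConnectedV S ∧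
    ∀ S', SubVASS S' V → ConnectedV S' → SubVASS S S' → SubVASS S' S

/-- `V` can be fully decomposed into SCCs: every transition belongs to some SCC. -/
def FullyDecomposable (V : VASS n L) : Prop :=
  ∀ t ∈ V.Trns, ∃ S, IsSCC V S ∧ t ∈ S.Trns

/-- The Kosaraju–Sullivan constraints (1)–(3): `Dμ ≥ 0`, `μ ≥ 0` and `Fμ = 0`
(the latter written out entrywise, with the oriented incidence matrix). -/
def NonNegCombo [DecidableEq L] (V : VASS n L) (μ : Transition n L → ℤ) : Prop :=
  (∀ i : Fin n, 0 ≤ ∑ t ∈ V.Trns, t.2.1 i * μ t) ∧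
  (∀ t ∈ V.Trns, 0 ≤ μ t) ∧
  (∀ l ∈ V.Locs,
    ∑ t ∈ V.Trns, ((if t.1 = l then (1 : ℤ) else 0) - (if t.2.2 = l then 1 else 0)) * μ t = 0)

/-- Constraint system (A_t). -/
def SatA [DecidableEq L] (V : VASS n L) (t₀ : Transition n L) : Prop :=
  ∃ μ : Transition n L → ℤ, NonNegCombo V μ ∧ 1 ≤ μ t₀

/-- Constraint system (B_t): `r ≥ 0`, `z ≥ 0` and `Dᵀr + Fᵀz ≤ 0`, with strict
inequality in row `t₀` (the row of `Fᵀz` at a transition `t` is `z(src t) - z(tgt t)`). -/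
def SatB (V : VASS n L) (t₀ : Transition n L) : Prop :=
  ∃ (r : Fin n → ℤ) (z : L → ℤ),
    (∀ i, 0 ≤ r i) ∧ (∀ l ∈ V.Locs, 0 ≤ z l) ∧
    (∀ t ∈ V.Trns, (∑ i, t.2.1 i * r i) + z t.1 - z t.2.2 ≤ 0) ∧
    (∑ i, t₀.2.1 i * r i) + z t₀.1 - z t₀.2.2 < 0

/-- The cone of cycle values of `V` (over ℚ). -/
def coneSet [DecidableEq L] (V : VASS n L) : Set (Fin n → ℚ) :=
  { x | ∃ μ : Transition n L → ℚ, (∀ t ∈ V.Trns, 0 ≤ μ t) ∧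
      (∀ l ∈ V.Locs,
        ∑ t ∈ V.Trns, ((if t.1 = l then (1 : ℚ) else 0) - (if t.2.2 = l then 1 else 0)) * μ t = 0) ∧
      x = fun i => ∑ t ∈ V.Trns, (t.2.1 i : ℚ) * μ t }

/-- The dimension of the smallest vector space containing the cone of `V`. -/
noncomputable def coneDim [DecidableEq L] (V : VASS n L) : ℕ :=
  Module.finrank ℚ (Submodule.span ℚ (coneSet V))

/-- Conservative VASS: the entries of each update vector sum to zero. -/
def Conservative (V : VASS n L) : Prop := ∀ t ∈ V.Trns, ∑ i, t.2.1 i = 0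

/-- The feasible region of the rational LP (C): `ρ ≥ 0`, `Dρ ≥ -1`, `Fρ = 0`. -/
def FeasC [DecidableEq L] (V : VASS n L) (ρ : Transition n L → ℚ) : Prop :=
  (∀ t ∈ V.Trns, 0 ≤ ρ t) ∧
  (∀ i : Fin n, (-1 : ℚ) ≤ ∑ t ∈ V.Trns, (t.2.1 i : ℚ) * ρ t) ∧
  (∀ l ∈ V.Locs,
    ∑ t ∈ V.Trns, ((if t.1 = l then (1 : ℚ) else 0) - (if t.2.2 = l then 1 else 0)) * ρ t = 0)
theorem le_foldr_max_of_mem {l : List ℕ} {x : ℕ} (h : x ∈ l) : x ≤ l.foldr max 0 := by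
  induction l with
  | nil => simp at h
  | cons a l ih =>
    rw [List.foldr_cons]
    rcases List.mem_cons.1 h with rfl | h
    · exact le_max_left _ _
    · exact (ih h).trans (le_max_right _ _)

/-- Partial sums of a periodic integer sequence with non-negative sum over a period and
entries of absolute value at most `m` are bounded below by `-(m * p)`. -/
theorem neg_mul_le_sum_range_of_periodic {f : ℕ → ℤ} {p m : ℕ} (hp : 0 < p)
    (hper : Function.Periodic f p) (hbound : ∀ k, |f k| ≤ m)
    (hsum : 0 ≤ ∑ j ∈ Finset.range p, f j) (k : ℕ) :
    -((m * p : ℕ) : ℤ) ≤ ∑ j ∈ Finset.range k, f j := by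
  induction k using Nat.strong_induction_on with
  | _ k ih =>
    rcases le_or_gt p k with hk | hk
    · obtain ⟨c, rfl⟩ := Nat.exists_eq_add_of_le hk
      have hshift : ∑ j ∈ Finset.range c, f (p + j) = ∑ j ∈ Finset.range c, f j :=
        Finset.sum_congr rfl fun j _ => by rw [add_comm, hper j]
      rw [Finset.sum_range_add, hshift]
      linarith [ih c (by omega)]
    · have hle : |∑ j ∈ Finset.range k, f j| ≤ k * m := by
        calc |∑ j ∈ Finset.range k, f j| ≤ ∑ j ∈ Finset.range k, |f j| :=
              Finset.abs_sum_le_sum_abs _ _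
          _ ≤ ∑ _j ∈ Finset.range k, (m : ℤ) := Finset.sum_le_sum fun j _ => hbound j
          _ = k * m := by simp
      have hmul : (k : ℤ) * m ≤ p * m := by gcongr
      push_cast
      linarith [neg_abs_le (∑ j ∈ Finset.range k, f j), mul_comm (m : ℤ) p]

/-- The cyclic unrolling of a cycle: the transition taken at time `k`. -/
def unroll (π : List (Transition n L)) (hπ : π ≠ []) (k : ℕ) : Transition n L :=
  π[k % π.length]'(Nat.mod_lt _ (List.length_pos_iff.2 hπ))

theorem unroll_mem (π : List (Transition n L)) (hπ : π ≠ []) (k : ℕ) : unroll π hπ k ∈ π :=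
  List.getElem_mem _

theorem unroll_periodic (π : List (Transition n L)) (hπ : π ≠ []) :
    Function.Periodic (unroll π hπ) π.length := fun k => by
  simp [unroll]

theorem unroll_tgt_eq_src_succ {V : VASS n L} {π : List (Transition n L)} (h : IsCycle V π)
    (k : ℕ) : (unroll π h.2.1 k).2.2 = (unroll π h.2.1 (k + 1)).1 := by
  obtain ⟨⟨-, hchain⟩, hne, hends⟩ := h
  have hlen := List.length_pos_iff.2 hne
  have hk := Nat.mod_lt k hlen
  rcases Nat.lt_or_ge (k % π.length + 1) π.length with hlt | hge
  · have hmod : (k + 1) % π.length = k % π.length + 1 := by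
      rw [Nat.add_mod, Nat.mod_eq_of_lt (a := 1) (by omega), Nat.mod_eq_of_lt hlt]
    simp only [unroll, hmod]
    exact List.isChain_iff_getElem.1 hchain _ hlt
  · have hlast : k % π.length = π.length - 1 := by omega
    have hmod : (k + 1) % π.length = 0 := by
      rw [Nat.add_mod, hlast, Nat.add_mod_mod, Nat.sub_add_cancel hlen, Nat.mod_self]
    simp only [unroll, hmod, hlast]
    rw [List.head?_eq_some_head hne, List.getLast?_eq_some_getLast hne] at hends
    simp only [Option.map_some, Option.some.injEq, List.head_eq_getElem,
      List.getLast_eq_getElem] at hends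
    exact hends.symm

theorem sum_unroll (π : List (Transition n L)) (hπ : π ≠ []) (i : Fin n) :
    ∑ j ∈ Finset.range π.length, (unroll π hπ j).2.1 i = pathVal π i := by
  have hval : pathVal π i = (π.map fun t => t.2.1 i).sum := by
    have h := map_list_sum (Pi.evalAddMonoidHom (fun _ : Fin n => ℤ) i) (π.map fun t => t.2.1)
    rwa [List.map_map] at h
  rw [hval, Finset.sum_range, ← Fin.sum_univ_fun_getElem]
  refine Finset.sum_congr rfl fun j _ => ?_
  simp [unroll, Nat.mod_eq_of_lt j.2]

/-- **A non-negative cycle witnesses non-termination.** If `V` has a non-negative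
cycle `π`, then `V` is not terminating; concretely, there is an infinite trace
starting at the start location of `π` with initial valuation `m·l` in every
component, where `l` is the length of `π` and `m` is the maximal absolute value
of the update entries on `π`. -/
theorem nonneg_cycle_implies_nontermination {n : ℕ} {L : Type} (V : VASS n L)
    (π : List (Transition n L)) (hcyc : IsCycle V π) (hnn : ∀ i, 0 ≤ pathVal π i) :
    ¬ Terminating V ∧
    ∃ ℓ v d, InfTrace V ℓ v d ∧
      π.head?.map (fun t => t.1) = some (ℓ 0) ∧
      v 0 = fun _ =>
        ((π.map (fun t => Finset.univ.sup (fun j => (t.2.1 j).natAbs))).foldr max 0) * π.length := by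
  have hne := hcyc.2.1
  set m := (π.map (fun t => Finset.univ.sup (fun j => (t.2.1 j).natAbs))).foldr max 0 with hm
  have hbound (i : Fin n) (k : ℕ) : |(unroll π hne k).2.1 i| ≤ m := by
    rw [Int.abs_eq_natAbs, Nat.cast_le]
    exact (Finset.le_sup (f := fun j => ((unroll π hne k).2.1 j).natAbs)
      (Finset.mem_univ i)).trans
      (le_foldr_max_of_mem (List.mem_map_of_mem (unroll_mem π hne k)))
  have hpos (i : Fin n) (k : ℕ) :
      0 ≤ ((m * π.length : ℕ) : ℤ) + ∑ j ∈ Finset.range k, (unroll π hne j).2.1 i := by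
    have := neg_mul_le_sum_range_of_periodic (List.length_pos_iff.2 hne)
      ((unroll_periodic π hne).comp fun t => t.2.1 i) (hbound i)
      ((hnn i).trans_eq (sum_unroll π hne i).symm) k
    simp only [Function.comp_apply] at this
    linarith
  have htrace : ∃ ℓ v d, InfTrace V ℓ v d ∧
      π.head?.map (fun t => t.1) = some (ℓ 0) ∧ v 0 = fun _ => m * π.length := by
    refine ⟨fun k => (unroll π hne k).1,
      fun k i => (((m * π.length : ℕ) : ℤ) +
        ∑ j ∈ Finset.range k, (unroll π hne j).2.1 i).toNat,
      fun k => (unroll π hne k).2.1, fun k => ⟨?_, fun i => ?_⟩, ?_, ?_⟩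
    · simp only [← unroll_tgt_eq_src_succ hcyc k]
      exact hcyc.1.1 _ (unroll_mem π hne k)
    · simp only [Int.toNat_of_nonneg (hpos i _)]
      rw [Finset.sum_range_succ, add_assoc]
    · simp [List.head?_eq_some_head hne, List.head_eq_getElem, unroll]
    · funext i
      simp only [Finset.range_zero, Finset.sum_empty, add_zero, Int.toNat_natCast]
  obtain ⟨ℓ, v, d, h, hstart⟩ := htrace
  exact ⟨fun hterm => hterm ⟨ℓ, v, d, h⟩, ℓ, v, d, h, hstart⟩

end VASSPaper
end

section
/- Completeness of the non-negative-cycle criterion: If a VASS V has an infinite trace, then V has a non-negative cycle. More precisely, every infinite trace (l0,v0) →_{d1} (l1,v1) →_{d2} ⋯ contains indices i < j with l_i = l_j and v_i ≤ v_j componentwise, so the segment of the trace between positions i and j projects to a non-negative cycle of V. -/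
namespace VASSPaper

variable {n : ℕ} {L : Type}

/-- An infinite trace visits two comparable states at the same location. -/
theorem InfTrace.exists_lt_eq_le {V : VASS n L} {ℓ : ℕ → L} {v : ℕ → Val n} {d : ℕ → Upd n}
    (h : InfTrace V ℓ v d) : ∃ i j, i < j ∧ ℓ i = ℓ j ∧ ∀ m, v i m ≤ v j m := by
  have hloc : WellQuasiOrdered (Eq : V.Locs → V.Locs → Prop) := Finite.wellQuasiOrdered _
  have hval : WellQuasiOrdered ((· ≤ ·) : Val n → Val n → Prop) := wellQuasiOrdered_le
  obtain ⟨i, j, hij, hl, hv⟩ :=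
    (hloc.prod hval) fun k => (⟨ℓ k, (V.valid _ (h k).1).1⟩, v k)
  exact ⟨i, j, hij, congrArg Subtype.val hl, hv⟩

/-- The segment of length `k` of a trace starting at position `i` is a path. -/
theorem InfTrace.isPath_segment {V : VASS n L} {ℓ : ℕ → L} {v : ℕ → Val n} {d : ℕ → Upd n}
    (h : InfTrace V ℓ v d) (i k : ℕ) :
    IsPath V ((List.range k).map fun m => (ℓ (i + m), d (i + m), ℓ (i + m + 1))) := by
  refine ⟨?_, ?_⟩
  · simp only [List.mem_map]
    rintro _ ⟨m, -, rfl⟩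
    exact (h (i + m)).1
  · refine List.isChain_iff_getElem.mpr fun m hm => ?_
    simp [add_assoc]

/-- The value of a segment of a trace is the difference of the valuations at its ends. -/
theorem InfTrace.pathVal_segment {V : VASS n L} {ℓ : ℕ → L} {v : ℕ → Val n} {d : ℕ → Upd n}
    (h : InfTrace V ℓ v d) (i k : ℕ) (c : Fin n) :
    pathVal ((List.range k).map fun m => (ℓ (i + m), d (i + m), ℓ (i + m + 1))) c =
      (v (i + k) c : ℤ) - v i c := by
  induction k with
  | zero => simp [pathVal]
  | succ k ih =>
    have hstep : (v (i + k + 1) c : ℤ) = v (i + k) c + d (i + k) c := (h (i + k)).2 c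
    simp only [pathVal, List.range_succ, List.map_append, List.sum_append, List.map_cons,
      List.map_nil, List.sum_singleton, Pi.add_apply] at ih ⊢
    rw [ih, ← add_assoc, hstep]
    ring

/-- **Completeness of the non-negative-cycle criterion.** Every infinite trace of `V`
contains positions `i < j` with equal locations and componentwise increasing
valuations, and the segment of the trace between them projects to a non-negative
cycle of `V`. -/
theorem infinite_trace_contains_nonneg_cycle {n : ℕ} {L : Type} (V : VASS n L)
    (ℓ : ℕ → L) (v : ℕ → Val n) (d : ℕ → Upd n) (h : InfTrace V ℓ v d) :
    ∃ i j, i < j ∧ ℓ i = ℓ j ∧ (∀ m, v i m ≤ v j m) ∧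
      IsCycle V ((List.range (j - i)).map (fun m => (ℓ (i + m), d (i + m), ℓ (i + m + 1)))) ∧
      ∀ m, 0 ≤ pathVal ((List.range (j - i)).map (fun m => (ℓ (i + m), d (i + m), ℓ (i + m + 1)))) m := by
  obtain ⟨i, j, hij, hl, hv⟩ := h.exists_lt_eq_le
  obtain ⟨k, rfl⟩ := Nat.exists_eq_add_of_lt hij
  have hk : i + k + 1 - i = k + 1 := by omega
  refine ⟨i, i + k + 1, hij, hl, hv, ⟨h.isPath_segment i _, by simp [hk], ?_⟩, fun m => ?_⟩
  · simp [hk, List.head?_range, List.getLast?_range, hl]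
  · rw [h.pathVal_segment, hk, ← add_assoc, sub_nonneg]
    exact_mod_cast hv m

end VASSPaper
end

section
/- Solutions of the Kosaraju–Sullivan constraints correspond to non-negative multi-cycles: For a VASS V of dimension n, a vector μ ∈ ℤ^{Trns(V)} satisfies Dμ ≥ 0, μ ≥ 0 and Fμ = 0 if and only if there exists a non-negative multi-cycle of V containing exactly μ(t) instances of transition t for each t ∈ Trns(V). -/
namespace VASSPaper

variable {n : ℕ} {L : Type}

section MultiCycleDecomposition

/-- A multiset of transitions is balanced if every location is entered as often as it is left. -/
def IsBalanced (S : Multiset (Transition n L)) : Prop :=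
  S.map (fun t => t.1) = S.map (fun t => t.2.2)

lemma IsBalanced.add {S T : Multiset (Transition n L)} (hS : IsBalanced S) (hT : IsBalanced T) :
    IsBalanced (S + T) := by
  unfold IsBalanced at *
  simp only [Multiset.map_add, hS, hT]

lemma IsBalanced.of_add_left {S T : Multiset (Transition n L)} (hS : IsBalanced S)
    (h : IsBalanced (S + T)) : IsBalanced T := by
  unfold IsBalanced at *
  rw [Multiset.map_add, Multiset.map_add, hS] at h
  exact add_left_cancel h

lemma IsPath.cons_sources_eq {V : VASS n L} {π : List (Transition n L)} :
    ∀ {a : Transition n L}, IsPath V (a :: π) →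
      ((a :: π).getLast (List.cons_ne_nil a π)).2.2 ::ₘ
          ((a :: π : List _) : Multiset (Transition n L)).map (fun t => t.1) =
        a.1 ::ₘ ((a :: π : List _) : Multiset (Transition n L)).map (fun t => t.2.2) := by
  induction π with
  | nil => intro a _; simpa using Multiset.cons_swap a.2.2 a.1 0
  | cons b π ih =>
    intro a h
    obtain ⟨hmem, hchain⟩ := h
    obtain ⟨hab, hchain⟩ := List.isChain_cons_cons.mp hchain
    have := ih ⟨fun t ht => hmem t (List.mem_cons_of_mem a ht), hchain⟩
    rw [List.getLast_cons (List.cons_ne_nil b π), ← Multiset.cons_coe a, Multiset.map_cons,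
      Multiset.map_cons, Multiset.cons_swap, this, hab]

lemma isCycle_cons_iff {V : VASS n L} {a : Transition n L} {π : List (Transition n L)} :
    IsCycle V (a :: π) ↔
      IsPath V (a :: π) ∧ a.1 = ((a :: π).getLast (List.cons_ne_nil a π)).2.2 := by
  simp [IsCycle, List.getLast?_eq_getLast_of_ne_nil]

lemma IsCycle.isBalanced {V : VASS n L} {C : List (Transition n L)} (h : IsCycle V C) :
    IsBalanced (C : Multiset (Transition n L)) := by
  cases C with
  | nil => exact absurd rfl h.2.1
  | cons a π =>
    obtain ⟨hpath, heq⟩ := isCycle_cons_iff.mp h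
    have := hpath.cons_sources_eq
    rw [← heq] at this
    exact (Multiset.cons_inj_right _).mp this

/-- The multiset of all transition instances of a collection of paths. -/
def instances (M : List (List (Transition n L))) : Multiset (Transition n L) :=
  (M.map (fun C => (C : Multiset (Transition n L)))).sum

@[simp] lemma instances_nil : instances ([] : List (List (Transition n L))) = 0 := rfl

@[simp] lemma instances_cons (C : List (Transition n L)) (M : List (List (Transition n L))) :
    instances (C :: M) = C + instances M := by
  simp [instances]

lemma count_instances [DecidableEq L] (M : List (List (Transition n L))) (t : Transition n L) :
    ((instances M).count t : ℤ) = (M.map (fun C => (C.count t : ℤ))).sum := by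
  induction M with
  | nil => simp
  | cons C M ih =>
    simp only [instances_cons, Multiset.count_add, Nat.cast_add, ih, List.map_cons, List.sum_cons,
      Multiset.coe_count]
    congr 3
    exact lawful_beq_subsingleton _ _

lemma multiVal_apply (M : List (List (Transition n L))) (i : Fin n) :
    multiVal M i = ((instances M).map (fun t => t.2.1 i)).sum := by
  induction M with
  | nil => simp [multiVal]
  | cons C M ih =>
    have hC : pathVal C i = (C.map (fun t => t.2.1 i)).sum := by
      induction C with
      | nil => simp [pathVal]
      | cons a C ihC =>
        have : pathVal (a :: C) i = a.2.1 i + pathVal C i := by simp [pathVal]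
        rw [this, ihC, List.map_cons, List.sum_cons]
    have : multiVal (C :: M) i = pathVal C i + multiVal M i := by simp [multiVal]
    rw [this, hC, ih]
    simp

lemma IsMultiCycle.instances_subset {V : VASS n L} {M : List (List (Transition n L))}
    (h : IsMultiCycle V M) : ∀ t ∈ instances M, t ∈ V.Trns := by
  induction M with
  | nil => simp
  | cons C M ih =>
    intro t ht
    rw [instances_cons, Multiset.mem_add] at ht
    rcases ht with ht | ht
    · exact (h C List.mem_cons_self).1.1 t ht
    · exact ih (fun C' hC' => h C' (List.mem_cons_of_mem C hC')) t ht

lemma IsMultiCycle.isBalanced {V : VASS n L} {M : List (List (Transition n L))}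
    (h : IsMultiCycle V M) : IsBalanced (instances M) := by
  induction M with
  | nil => simp [IsBalanced]
  | cons C M ih =>
    rw [instances_cons]
    exact (h C List.mem_cons_self).isBalanced.add
      (ih fun C' hC' => h C' (List.mem_cons_of_mem C hC'))

/-- A path together with further transitions, balanced as a whole, can be rearranged into a
multi-cycle: extend the path backwards until it closes up. -/
lemma IsPath.exists_isMultiCycle_instances_eq [DecidableEq L] {V : VASS n L}
    (π : List (Transition n L)) (R : Multiset (Transition n L)) (hπ : IsPath V π)
    (hR : ∀ t ∈ R, t ∈ V.Trns) (hbal : IsBalanced ((π : Multiset (Transition n L)) + R)) :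
    ∃ M, IsMultiCycle V M ∧ instances M = (π : Multiset (Transition n L)) + R := by
  match π with
  | [] =>
    rcases R.empty_or_exists_mem with rfl | ⟨t, ht⟩
    · exact ⟨[], by simp [IsMultiCycle], by simp⟩
    · obtain ⟨R', rfl⟩ := Multiset.exists_cons_of_mem ht
      have heq : (([t] : List _) : Multiset (Transition n L)) + R' =
          (([] : List (Transition n L)) : Multiset (Transition n L)) + t ::ₘ R' := by
        simp
      rw [← heq] at hbal ⊢
      exact exists_isMultiCycle_instances_eq [t] R'
        ⟨by simpa using hR t ht, List.isChain_singleton t⟩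
        (fun s hs => hR s (Multiset.mem_cons_of_mem hs)) hbal
  | a :: π =>
    by_cases hc : a.1 = ((a :: π).getLast (List.cons_ne_nil a π)).2.2
    · have hcyc : IsCycle V (a :: π) := isCycle_cons_iff.mpr ⟨hπ, hc⟩
      obtain ⟨M, hM, hMR⟩ := exists_isMultiCycle_instances_eq [] R
        ⟨by simp, List.isChain_nil⟩ hR (by simpa using hcyc.isBalanced.of_add_left hbal)
      refine ⟨(a :: π) :: M, ?_, by simp [hMR]⟩
      intro C hC
      rcases List.mem_cons.mp hC with rfl | hC
      · exact hcyc
      · exact hM C hC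
    · have hmem : a.1 ∈ R.map (fun t => t.2.2) := by
        have h₁ := hπ.cons_sources_eq
        have h₂ := hbal
        unfold IsBalanced at h₂
        rw [Multiset.map_add, Multiset.map_add] at h₂
        have c₁ := congrArg (Multiset.count a.1) h₁
        have c₂ := congrArg (Multiset.count a.1) h₂
        rw [Multiset.count_cons_of_ne hc, Multiset.count_cons_self] at c₁
        rw [Multiset.count_add, Multiset.count_add] at c₂
        exact Multiset.count_pos.mp (by omega)
      obtain ⟨t, ht, hta⟩ := Multiset.mem_map.mp hmem
      obtain ⟨R', rfl⟩ := Multiset.exists_cons_of_mem ht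
      have heq : ((t :: a :: π : List _) : Multiset (Transition n L)) + R' =
          ((a :: π : List _) : Multiset (Transition n L)) + t ::ₘ R' := by
        rw [← Multiset.cons_coe t, Multiset.cons_add, Multiset.add_cons]
      rw [← heq] at hbal ⊢
      exact exists_isMultiCycle_instances_eq (t :: a :: π) R'
        ⟨List.forall_mem_cons.mpr ⟨hR t ht, hπ.1⟩, List.isChain_cons_cons.mpr ⟨hta, hπ.2⟩⟩
        (fun s hs => hR s (Multiset.mem_cons_of_mem hs)) hbal
termination_by 2 * Multiset.card R + min 1 π.length
decreasing_by all_goals (subst_vars; simp; try omega)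

lemma sum_mul_count [DecidableEq L] {T : Finset (Transition n L)}
    {S : Multiset (Transition n L)} (hS : ∀ t ∈ S, t ∈ T) (f : Transition n L → ℤ) :
    ∑ t ∈ T, f t * (S.count t : ℤ) = (S.map f).sum := by
  rw [Finset.sum_multiset_map_count]
  simp only [nsmul_eq_mul, mul_comm]
  refine (Finset.sum_subset (fun t ht => hS t (Multiset.mem_toFinset.mp ht)) fun t _ ht => ?_).symm
  simp [Multiset.count_eq_zero.mpr (fun h => ht (Multiset.mem_toFinset.mpr h))]

lemma sum_incidence [DecidableEq L] (S : Multiset (Transition n L)) (l : L) :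
    (S.map (fun t => (if t.1 = l then (1 : ℤ) else 0) - (if t.2.2 = l then 1 else 0))).sum =
      ((S.map (fun t => t.1)).count l : ℤ) - ((S.map (fun t => t.2.2)).count l : ℤ) := by
  induction S using Multiset.induction_on with
  | empty => simp
  | cons a S ih =>
    simp only [Multiset.map_cons, Multiset.sum_cons, ih, Multiset.count_cons, eq_comm (a := l)]
    push_cast
    ring

lemma isBalanced_iff_sum_incidence_eq_zero [DecidableEq L] {V : VASS n L}
    {S : Multiset (Transition n L)} (hS : ∀ t ∈ S, t ∈ V.Trns) :
    IsBalanced S ↔ ∀ l ∈ V.Locs,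
      (S.map (fun t =>
        (if t.1 = l then (1 : ℤ) else 0) - (if t.2.2 = l then 1 else 0))).sum = 0 := by
  simp only [sum_incidence, sub_eq_zero, Nat.cast_inj]
  refine ⟨fun h l _ => by rw [h], fun h => Multiset.ext.mpr fun l => ?_⟩
  by_cases hl : l ∈ V.Locs
  · exact h l hl
  · rw [Multiset.count_eq_zero.mpr, Multiset.count_eq_zero.mpr]
    · intro hmem
      obtain ⟨t, ht, rfl⟩ := Multiset.mem_map.mp hmem
      exact hl (V.valid t (hS t ht)).2
    · intro hmem
      obtain ⟨t, ht, rfl⟩ := Multiset.mem_map.mp hmem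
      exact hl (V.valid t (hS t ht)).1

lemma nonNegCombo_iff_of_count [DecidableEq L] {V : VASS n L} {μ : Transition n L → ℤ}
    {S : Multiset (Transition n L)} (hS : ∀ t ∈ S, t ∈ V.Trns)
    (hμ : ∀ t ∈ V.Trns, μ t = S.count t) :
    NonNegCombo V μ ↔ (∀ i, 0 ≤ (S.map (fun t => t.2.1 i)).sum) ∧ IsBalanced S := by
  have key (f : Transition n L → ℤ) : ∑ t ∈ V.Trns, f t * μ t = (S.map f).sum := by
    rw [← sum_mul_count hS]
    exact Finset.sum_congr rfl fun t ht => by rw [hμ t ht]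
  have hnonneg : ∀ t ∈ V.Trns, 0 ≤ μ t := fun t ht => by rw [hμ t ht]; positivity
  rw [NonNegCombo, isBalanced_iff_sum_incidence_eq_zero hS]
  simp only [key]
  tauto

lemma exists_multiset_count_eq [DecidableEq L] {T : Finset (Transition n L)}
    {μ : Transition n L → ℤ} (hμ : ∀ t ∈ T, 0 ≤ μ t) :
    ∃ S : Multiset (Transition n L), (∀ t ∈ S, t ∈ T) ∧ ∀ t ∈ T, μ t = S.count t := by
  refine ⟨∑ t ∈ T, (μ t).toNat • {t}, fun t ht => ?_, fun t ht => ?_⟩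
  · obtain ⟨s, hs, hts⟩ := Multiset.mem_sum.mp ht
    rwa [Multiset.mem_singleton.mp (Multiset.mem_of_mem_nsmul hts)]
  · simp [Multiset.count_sum', Multiset.count_singleton, ht, hμ t ht]

end MultiCycleDecomposition

/-- **Kosaraju–Sullivan constraints correspond to non-negative multi-cycles.**
`μ` satisfies `Dμ ≥ 0`, `μ ≥ 0`, `Fμ = 0` iff there is a non-negative multi-cycle
of `V` containing exactly `μ(t)` instances of each transition `t ∈ Trns(V)`. -/
theorem solution_iff_nonneg_multicycle {n : ℕ} {L : Type} [DecidableEq L]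
    (V : VASS n L) (μ : Transition n L → ℤ) :
    NonNegCombo V μ ↔
      ∃ M : List (List (Transition n L)), IsMultiCycle V M ∧ (∀ i, 0 ≤ multiVal M i) ∧
        ∀ t ∈ V.Trns, μ t = ((M.map (fun C => (C.count t : ℤ))).sum) := by
  constructor
  · intro h
    obtain ⟨S, hS, hμ⟩ := exists_multiset_count_eq h.2.1
    obtain ⟨hval, hbal⟩ := (nonNegCombo_iff_of_count hS hμ).mp h
    obtain ⟨M, hM, hMS⟩ := IsPath.exists_isMultiCycle_instances_eq (V := V) [] S
      ⟨by simp, List.isChain_nil⟩ hS (by simpa using hbal)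
    rw [Multiset.coe_nil, zero_add] at hMS
    refine ⟨M, hM, fun i => ?_, fun t ht => ?_⟩
    · rw [multiVal_apply, hMS]
      exact hval i
    · rw [← count_instances, hMS, hμ t ht]
  · rintro ⟨M, hM, hval, hμ⟩
    refine (nonNegCombo_iff_of_count hM.instances_subset fun t ht => ?_).mpr
      ⟨fun i => ?_, hM.isBalanced⟩
    · rw [count_instances, hμ t ht]
    · rw [← multiVal_apply]
      exact hval i

end VASSPaper
end

section
/- If V is a connected VASS and there is a vector μ ∈ ℤ^{Trns(V)} with μ(t) ≥ 1 for every transition t, Dμ ≥ 0 and Fμ = 0, then V has a non-negative cycle that includes every transition of V. -/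
namespace VASSPaper

variable {n : ℕ} {L : Type}

/-- `Walk a p b`: the list of transitions `p` forms a (possibly empty) walk from `a` to `b`. -/
def Walk (a : L) : List (Transition n L) → L → Prop
  | [], b => a = b
  | t :: p, b => t.1 = a ∧ Walk t.2.2 p b

theorem Walk.append {a b c : L} {p q : List (Transition n L)} (hp : Walk a p b)
    (hq : Walk b q c) : Walk a (p ++ q) c := by
  induction p generalizing a with
  | nil => cases hp; exact hq
  | cons t p ih => exact ⟨hp.1, ih hp.2⟩

theorem walk_append_iff {a c : L} {p q : List (Transition n L)} :
    Walk a (p ++ q) c ↔ ∃ b, Walk a p b ∧ Walk b q c := by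
  refine ⟨fun h => ?_, fun ⟨b, hp, hq⟩ => hp.append hq⟩
  induction p generalizing a with
  | nil => exact ⟨a, rfl, h⟩
  | cons t p ih =>
    obtain ⟨b, hb, hc⟩ := ih h.2
    exact ⟨b, ⟨h.1, hb⟩, hc⟩

theorem Walk.isChain {a b : L} {p : List (Transition n L)} (h : Walk a p b) :
    p.IsChain (fun t₁ t₂ => t₁.2.2 = t₂.1) := by
  induction p generalizing a with
  | nil => simp
  | cons t p ih =>
    refine List.isChain_cons.2 ⟨?_, ih h.2⟩
    cases p with
    | nil => simp
    | cons u p => simpa using h.2.1.symm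

theorem Walk.head?_map {a b : L} {p : List (Transition n L)} (h : Walk a p b) (hp : p ≠ []) :
    p.head?.map (fun t => t.1) = some a := by
  cases p with
  | nil => exact absurd rfl hp
  | cons t p => simpa using h.1

theorem Walk.getLast?_map {a b : L} {p : List (Transition n L)} (h : Walk a p b) (hp : p ≠ []) :
    p.getLast?.map (fun t => t.2.2) = some b := by
  induction p generalizing a with
  | nil => exact absurd rfl hp
  | cons t p ih =>
    cases p with
    | nil => simpa [Walk] using h.2
    | cons u p => simpa [List.getLast?_cons_cons] using ih h.2 (by simp)

theorem Walk.countP_add [DecidableEq L] {a b : L} {p : List (Transition n L)} (h : Walk a p b)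
    (l : L) :
    p.countP (fun t => t.1 = l) + (if b = l then 1 else 0) =
      p.countP (fun t => t.2.2 = l) + (if a = l then 1 else 0) := by
  induction p generalizing a with
  | nil => cases h; simp
  | cons t p ih =>
    have := ih h.2
    have h1 := h.1
    subst h1
    simp only [List.countP_cons, decide_eq_true_eq]
    omega

/-- A longest walk inside a balanced multiset of transitions is closed. -/
theorem Walk.closed_of_maximal [DecidableEq L] {M : Multiset (Transition n L)}
    (hM : ∀ l, M.countP (fun t => t.1 = l) = M.countP (fun t => t.2.2 = l))
    {a b : L} {p : List (Transition n L)} (h : Walk a p b) (hp : (p : Multiset _) ≤ M)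
    (hmax : ∀ a' b' q, Walk a' q b' → ((q : List (Transition n L)) : Multiset _) ≤ M →
      q.length ≤ p.length) : a = b := by
  by_contra hab
  have h1 := h.countP_add b
  simp only [if_true, if_neg hab] at h1
  have h2 := Multiset.countP_le_of_le (fun t : Transition n L => t.2.2 = b) hp
  obtain ⟨r, rfl⟩ := Multiset.le_iff_exists_add.1 hp
  have h3 := hM b
  simp only [Multiset.countP_add, Multiset.coe_countP] at h2 h3
  have h4 : 0 < r.countP (fun t => t.1 = b) := by omega
  obtain ⟨t, ht, rfl⟩ := Multiset.countP_pos.1 h4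
  have := hmax a t.2.2 (p ++ [t]) (h.append ⟨rfl, rfl⟩) (by
    rw [← Multiset.coe_add]
    exact add_le_add_right (by simpa using ht) _)
  simp at this

/-- A connected balanced multiset of transitions is traversed by a closed walk. -/
theorem exists_eulerian_walk [DecidableEq L] {V : VASS n L} (hconn : ConnectedV V)
    (hne : V.Trns.Nonempty) {M : Multiset (Transition n L)} (hmem : ∀ t, t ∈ M ↔ t ∈ V.Trns)
    (hM : ∀ l, M.countP (fun t => t.1 = l) = M.countP (fun t => t.2.2 = l)) :
    ∃ (a : L) (p : List (Transition n L)), Walk a p a ∧ (p : Multiset _) = M := by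
  obtain ⟨p, ⟨⟨a, b, hw⟩, hle⟩, hmax'⟩ := Set.Finite.exists_maximalFor List.length
    {p : List (Transition n L) | (∃ a b, Walk a p b) ∧ (p : Multiset _) ≤ M}
    (by
      have : {p : List (Transition n L) | (p : Multiset _) ≤ M}.Finite := by
        refine (Set.finite_Iic M).preimage' 
          (f := fun p : List (Transition n L) => (p : Multiset _)) fun s _ => ?_
        exact (Multiset.lists s).finite_toSet.subset fun p hp => by
          simpa using (Multiset.mem_lists_iff s p).2 hp.symm
      exact this.subset fun p hp => hp.2)
    ⟨[], ⟨hne.choose.1, _, rfl⟩, by simp⟩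
  have hmax : ∀ a' b' q, Walk a' q b' → ((q : List (Transition n L)) : Multiset _) ≤ M →
      q.length ≤ p.length := fun a' b' q h1 h2 => by
    by_contra hlt
    exact hlt (hmax' ⟨⟨a', b', h1⟩, h2⟩ (by omega))
  obtain rfl := hw.closed_of_maximal hM hle hmax
  have hvis : ∀ q₁ q₂ x, p = q₁ ++ q₂ → Walk a q₁ x → Walk x q₂ a →
      ∀ t ∈ M - (p : Multiset _), t.1 ≠ x := by
    rintro q₁ q₂ x hpq h1 h2 t ht rfl
    have := hmax t.1 t.2.2 (q₂ ++ q₁ ++ [t]) ((h2.append h1).append ⟨rfl, rfl⟩) (by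
      have hperm : ((q₂ ++ q₁ : List _) : Multiset (Transition n L)) = p := by
        rw [hpq]; exact Multiset.coe_eq_coe.2 List.perm_append_comm
      rw [← Multiset.coe_add, hperm, ← add_tsub_cancel_of_le hle]
      exact add_le_add_right (by simpa using ht) _)
    simp [hpq] at this
    omega
  have hout : ∀ q₁ q₂ x, p = q₁ ++ q₂ → Walk a q₁ x → Walk x q₂ a →
      ∀ t ∈ V.Trns, t.1 = x → t ∈ p := by
    intro q₁ q₂ x hpq h1 h2 t ht htx
    by_contra htp
    refine hvis q₁ q₂ x hpq h1 h2 t ?_ htx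
    rw [← add_tsub_cancel_of_le hle] at hmem
    simpa [htp] using (hmem t).2 ht
  obtain ⟨t₀, ht₀⟩ := hne
  have ha : a ∈ V.Locs := by
    cases p with
    | nil =>
      have := hmax t₀.1 t₀.2.2 [t₀] ⟨rfl, rfl⟩ (by simpa using (hmem t₀).2 ht₀)
      simp at this
    | cons t p =>
      have := (V.valid t ((hmem t).1 (Multiset.mem_of_le hle (by simp)))).1
      rwa [hw.1] at this
  have hall : ∀ x, Reaches V a x → ∃ q₁ q₂, p = q₁ ++ q₂ ∧ Walk a q₁ x ∧ Walk x q₂ a := by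
    intro x hx
    induction hx with
    | refl => exact ⟨[], p, rfl, rfl, hw⟩
    | tail _ hstep ih =>
      obtain ⟨d, hd⟩ := hstep
      obtain ⟨q₁, q₂, hpq, h1, h2⟩ := ih
      obtain ⟨r₁, r₂, hr⟩ := List.append_of_mem (hout q₁ q₂ _ hpq h1 h2 _ hd rfl)
      obtain ⟨y, hy, hy'⟩ := walk_append_iff.1 (hr ▸ hw)
      exact ⟨r₁ ++ [_], r₂, by simpa using hr, hy.append ⟨hy'.1, rfl⟩, hy'.2⟩
  refine ⟨a, p, hw, hle.antisymm (tsub_eq_zero_iff_le.1 (Multiset.eq_zero_of_forall_notMem ?_))⟩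
  intro t ht
  have htV := (hmem t).1 (Multiset.mem_of_le tsub_le_self ht)
  obtain ⟨q₁, q₂, hpq, h1, h2⟩ := hall t.1 (hconn a ha _ (V.valid t htV).1)
  exact hvis q₁ q₂ _ hpq h1 h2 t ht rfl

/-- **A strictly positive solution yields a non-negative cycle through all transitions.**
If `V` is connected (and has at least one transition) and `μ` satisfies `μ(t) ≥ 1` for
every transition, `Dμ ≥ 0` and `Fμ = 0`, then `V` has a non-negative cycle that
includes every transition of `V`. -/
theorem positive_solution_gives_full_nonneg_cycle {n : ℕ} {L : Type} [DecidableEq L]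
    (V : VASS n L) (hconn : ConnectedV V) (hne : V.Trns.Nonempty)
    (μ : Transition n L → ℤ) (hμ1 : ∀ t ∈ V.Trns, 1 ≤ μ t)
    (hD : ∀ i : Fin n, 0 ≤ ∑ t ∈ V.Trns, t.2.1 i * μ t)
    (hF : ∀ l ∈ V.Locs,
      ∑ t ∈ V.Trns, ((if t.1 = l then (1 : ℤ) else 0) - (if t.2.2 = l then 1 else 0)) * μ t = 0) :
    ∃ π, IsCycle V π ∧ (∀ i, 0 ≤ pathVal π i) ∧ ∀ t ∈ V.Trns, t ∈ π := by
  set M : Multiset (Transition n L) := ∑ t ∈ V.Trns, (μ t).toNat • {t} with hMdef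
  have hmem : ∀ t, t ∈ M ↔ t ∈ V.Trns := by
    intro t
    simp only [hMdef, Multiset.mem_sum, Multiset.mem_nsmul, Multiset.mem_singleton]
    constructor
    · rintro ⟨u, hu, -, rfl⟩
      exact hu
    · intro ht
      have := hμ1 t ht
      exact ⟨t, ht, by omega, rfl⟩
  have hcount : ∀ (q : Transition n L → Prop) [DecidablePred q],
      (M.countP q : ℤ) = ∑ t ∈ V.Trns, (if q t then 1 else 0) * μ t := by
    intro q _
    rw [hMdef, ← Multiset.coe_countPAddMonoidHom, map_sum, Nat.cast_sum]
    refine Finset.sum_congr rfl fun t ht => ?_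
    have := hμ1 t ht
    by_cases hq : q t <;> simp [Multiset.countP_nsmul, ← Multiset.cons_zero, hq]
    omega
  have hM : ∀ l, M.countP (fun t => t.1 = l) = M.countP (fun t => t.2.2 = l) := by
    intro l
    by_cases hl : l ∈ V.Locs
    · have := hF l hl
      simp only [sub_mul, Finset.sum_sub_distrib] at this
      zify
      rw [hcount, hcount]
      linarith
    · rw [Multiset.countP_eq_zero.2, Multiset.countP_eq_zero.2]
      · rintro t ht rfl
        exact hl (V.valid t ((hmem t).1 ht)).2
      · rintro t ht rfl
        exact hl (V.valid t ((hmem t).1 ht)).1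
  obtain ⟨a, p, hw, hp⟩ := exists_eulerian_walk hconn hne hmem hM
  have hmem' : ∀ t, t ∈ p ↔ t ∈ V.Trns := fun t => by rw [← hmem, ← hp, Multiset.mem_coe]
  have hp0 : p ≠ [] := List.ne_nil_of_mem ((hmem' _).2 hne.choose_spec)
  refine ⟨p, ⟨⟨fun t ht => (hmem' t).1 ht, hw.isChain⟩, hp0, ?_⟩, fun i => ?_,
    fun t ht => (hmem' t).2 ht⟩
  · rw [hw.head?_map hp0, hw.getLast?_map hp0]
  · convert hD i using 1
    have hval : pathVal p = (M.map fun t => t.2.1).sum := by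
      rw [← hp, Multiset.map_coe, Multiset.sum_coe, pathVal]
    rw [hval, hMdef, ← Multiset.coe_mapAddMonoidHom, map_sum, ← Multiset.coe_sumAddMonoidHom,
      map_sum, Finset.sum_apply]
    refine Finset.sum_congr rfl fun t ht => ?_
    have := hμ1 t ht
    simp [Multiset.map_nsmul, Multiset.sum_nsmul, mul_comm]
    left
    omega

end VASSPaper
end

section
/- Duality of the constraint systems: For every VASS V of dimension n and every transition t ∈ Trns(V), exactly one of the following two constraint systems has an integer solution. (A_t): there exists μ ∈ ℤ^{Trns(V)} with Dμ ≥ 0, μ ≥ 0, Fμ = 0 and μ(t) ≥ 1. (B_t): there exist r ∈ ℤ^n and z ∈ ℤ^{Locs(V)} with r ≥ 0, z ≥ 0 and D^T r + F^T z ≤ 0, where the inequality is strict in the row indexed by t. -/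
namespace VASSPaper

variable {n : ℕ} {L : Type}

/-- Farkas' lemma over a linearly ordered field: a linear functional that is nonpositive wherever
finitely many given functionals are nonpositive is a nonnegative combination of them. -/
theorem farkas {𝕜 W ι : Type*} [Field 𝕜] [LinearOrder 𝕜] [IsStrictOrderedRing 𝕜]
    [AddCommGroup W] [Module 𝕜 W] (s : Finset ι) (A : ι → W →ₗ[𝕜] 𝕜) (b : W →ₗ[𝕜] 𝕜)
    (h : ∀ x, (∀ i ∈ s, A i x ≤ 0) → b x ≤ 0) :
    ∃ c : ι → 𝕜, (∀ i, 0 ≤ c i) ∧ b = ∑ i ∈ s, c i • A i := by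
  classical
  induction s using Finset.induction_on generalizing A b with
  | empty =>
    refine ⟨0, fun _ => le_rfl, ?_⟩
    ext x
    have h₁ := h x (by simp)
    have h₂ := h (-x) (by simp)
    simp only [map_neg] at h₂
    simp only [Finset.sum_empty, LinearMap.zero_apply]
    linarith
  | insert j s hj ih =>
    have hupd (c : ι → 𝕜) (v : 𝕜) :
        ∑ i ∈ insert j s, Function.update c j v i • A i = v • A j + ∑ i ∈ s, c i • A i := by
      rw [Finset.sum_insert hj, Function.update_self]
      congr 1
      refine Finset.sum_congr rfl fun i hi => ?_
      rw [Function.update_of_ne (ne_of_mem_of_not_mem hi hj)]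
    by_cases hb : ∀ x, (∀ i ∈ s, A i x ≤ 0) → b x ≤ 0
    · obtain ⟨c, hc, hbc⟩ := ih A b hb
      refine ⟨Function.update c j 0, fun i => ?_, ?_⟩
      · by_cases hij : i = j
        · subst hij; simp
        · simpa [hij] using hc i
      · rw [hupd, zero_smul, zero_add, hbc]
    · push Not at hb
      obtain ⟨x₀, hx₀, hbx₀⟩ := hb
      have hj₀ : 0 < A j x₀ := by
        by_contra! hle
        refine absurd (h x₀ fun i hi => ?_) (not_le.2 hbx₀)
        rcases Finset.mem_insert.1 hi with rfl | hi
        exacts [hle, hx₀ i hi]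
      obtain ⟨y, hy, hby, hjy⟩ : ∃ y, (∀ i ∈ s, A i y ≤ 0) ∧ 0 < b y ∧ A j y = 1 := by
        refine ⟨(A j x₀)⁻¹ • x₀, fun i hi => ?_, ?_, ?_⟩
        · simpa using mul_nonpos_of_nonneg_of_nonpos (inv_pos.2 hj₀).le (hx₀ i hi)
        · simpa using mul_pos (inv_pos.2 hj₀) hbx₀
        · simp [hj₀.ne']
      obtain ⟨c, hc, hbc⟩ := ih (fun i => A i - A i y • A j) (b - b y • A j) (by
        intro x hx
        have key := h (x - A j x • y) (by
          intro i hi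
          rcases Finset.mem_insert.1 hi with rfl | hi
          · simp [hjy]
          · have := hx i hi
            simp only [LinearMap.sub_apply, LinearMap.smul_apply, smul_eq_mul] at this
            simp only [map_sub, map_smul, smul_eq_mul]
            linarith [mul_comm (A i y) (A j x)])
        simp only [map_sub, map_smul, smul_eq_mul] at key
        simp only [LinearMap.sub_apply, LinearMap.smul_apply, smul_eq_mul]
        linarith [mul_comm (b y) (A j x)])
      refine ⟨Function.update c j (b y - ∑ i ∈ s, c i * A i y), fun i => ?_, ?_⟩
      · by_cases hij : i = j
        · subst hij
          have : ∑ k ∈ s, c k * A k y ≤ 0 :=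
            Finset.sum_nonpos fun k hk => mul_nonpos_of_nonneg_of_nonpos (hc k) (hy k hk)
          simp only [Function.update_self]
          linarith
        · simpa [hij] using hc i
      · rw [hupd]
        refine (sub_eq_iff_eq_add.1 hbc).trans ?_
        ext x
        simp only [LinearMap.add_apply, LinearMap.sub_apply, LinearMap.smul_apply,
          LinearMap.sum_apply, smul_eq_mul, mul_sub, sub_mul, Finset.sum_sub_distrib,
          Finset.sum_mul, mul_assoc]
        ring

/-- Finitely many rationals have a positive common denominator. -/
theorem exists_common_denominator {ι : Type*} (s : Finset ι) (f : ι → ℚ) :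
    ∃ N : ℤ, 0 < N ∧ ∃ g : ι → ℤ, ∀ i ∈ s, (g i : ℚ) = N * f i := by
  classical
  induction s using Finset.induction_on with
  | empty => exact ⟨1, one_pos, 0, by simp⟩
  | insert j s hj ih =>
    obtain ⟨N, hN, g, hg⟩ := ih
    refine ⟨N * (f j).den, mul_pos hN (by exact_mod_cast (f j).den_pos),
      Function.update (fun i => g i * (f j).den) j (N * (f j).num), fun i hi => ?_⟩
    rcases Finset.mem_insert.1 hi with rfl | hi
    · rw [Function.update_self]
      push_cast
      rw [mul_assoc, Rat.den_mul_eq_num]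
    · rw [Function.update_of_ne (ne_of_mem_of_not_mem hi hj)]
      push_cast
      rw [hg i hi]
      ring

/-- The row of `Dᵀr + Fᵀz` at the transition `t`, as a rational linear functional of `(r, z)`. -/
def rowFunctional (t : Transition n L) : ((Fin n → ℚ) × (L → ℚ)) →ₗ[ℚ] ℚ where
  toFun x := (∑ i, (t.2.1 i : ℚ) * x.1 i) + x.2 t.1 - x.2 t.2.2
  map_add' x y := by
    simp only [Prod.fst_add, Prod.snd_add, Pi.add_apply, mul_add, Finset.sum_add_distrib]
    ring
  map_smul' c x := by
    simp only [Prod.smul_fst, Prod.smul_snd, Pi.smul_apply, smul_eq_mul, RingHom.id_apply,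
      mul_sub, mul_add, Finset.mul_sum, mul_left_comm]

theorem rowFunctional_apply (t : Transition n L) (x : (Fin n → ℚ) × (L → ℚ)) :
    rowFunctional t x = (∑ i, (t.2.1 i : ℚ) * x.1 i) + x.2 t.1 - x.2 t.2.2 := rfl

/-- The systems (A_t) and (B_t) exclude each other. -/
theorem SatA.not_satB [DecidableEq L] {V : VASS n L} {t : Transition n L} (ht : t ∈ V.Trns)
    (hA : SatA V t) : ¬ SatB V t := by
  rintro ⟨r, z, hr, -, hrow, hstrict⟩
  obtain ⟨μ, ⟨hD, hμ, hF⟩, hμt⟩ := hA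
  have hneg : ∑ s ∈ V.Trns, ((∑ i, s.2.1 i * r i) + z s.1 - z s.2.2) * μ s < 0 :=
    Finset.sum_neg' (fun s hs => mul_nonpos_of_nonpos_of_nonneg (hrow s hs) (hμ s hs))
      ⟨t, ht, mul_neg_of_neg_of_pos hstrict (by linarith)⟩
  have hz : ∑ s ∈ V.Trns, (z s.1 - z s.2.2) * μ s = 0 := by
    have : ∑ l ∈ V.Locs, z l * ∑ s ∈ V.Trns,
        ((if s.1 = l then (1 : ℤ) else 0) - (if s.2.2 = l then 1 else 0)) * μ s = 0 :=
      Finset.sum_eq_zero fun l hl => by rw [hF l hl, mul_zero]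
    rw [← this]
    simp only [Finset.mul_sum]
    rw [Finset.sum_comm]
    refine Finset.sum_congr rfl fun s hs => ?_
    simp only [← mul_assoc, mul_sub, ← Finset.sum_mul, Finset.sum_sub_distrib, mul_ite, mul_one,
      mul_zero, Finset.sum_ite_eq, (V.valid s hs).1, (V.valid s hs).2, if_true]
  have hpos : 0 ≤ ∑ s ∈ V.Trns, (∑ i, s.2.1 i * r i) * μ s := by
    have : 0 ≤ ∑ i, r i * ∑ s ∈ V.Trns, s.2.1 i * μ s :=
      Finset.sum_nonneg fun i _ => mul_nonneg (hr i) (hD i)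
    refine this.trans_eq ?_
    simp only [Finset.mul_sum, Finset.sum_mul]
    rw [Finset.sum_comm]
    exact Finset.sum_congr rfl fun s _ => Finset.sum_congr rfl fun i _ => by ring
  have hsplit : ∑ s ∈ V.Trns, ((∑ i, s.2.1 i * r i) + z s.1 - z s.2.2) * μ s =
      ∑ s ∈ V.Trns, (∑ i, s.2.1 i * r i) * μ s + ∑ s ∈ V.Trns, (z s.1 - z s.2.2) * μ s := by
    rw [← Finset.sum_add_distrib]
    exact Finset.sum_congr rfl fun s _ => by ring
  linarith

/-- A rational solution of (B_t), without the sign condition on `z`, yields an integer one. -/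
theorem satB_of_rat {V : VASS n L} {t : Transition n L} (ht : t ∈ V.Trns)
    (x : (Fin n → ℚ) × (L → ℚ)) (hr : ∀ i, 0 ≤ x.1 i)
    (hrow : ∀ s ∈ V.Trns, rowFunctional s x ≤ 0) (hstrict : rowFunctional t x < 0) :
    SatB V t := by
  obtain ⟨N, hN, g, hg⟩ := exists_common_denominator (Finset.univ.disjSum V.Locs)
    (Sum.elim x.1 x.2)
  have hN' : (0 : ℚ) < N := by exact_mod_cast hN
  have hgr (i : Fin n) : (g (.inl i) : ℚ) = N * x.1 i := hg (.inl i) (by simp)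
  have hgz {l : L} (hl : l ∈ V.Locs) : (g (.inr l) : ℚ) = N * x.2 l :=
    hg (.inr l) (by simpa using hl)
  have hval {s : Transition n L} (hs : s ∈ V.Trns) :
      (((∑ i, s.2.1 i * g (.inl i)) + g (.inr s.1) - g (.inr s.2.2) : ℤ) : ℚ) =
        N * rowFunctional s x := by
    push_cast
    rw [rowFunctional_apply, hgz (V.valid s hs).1, hgz (V.valid s hs).2]
    simp only [hgr, mul_sub, mul_add, Finset.mul_sum, mul_left_comm]
  have hle {l : L} (hl : l ∈ V.Locs) : |g (.inr l)| ≤ ∑ k ∈ V.Locs, |g (.inr k)| :=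
    Finset.single_le_sum (f := fun k => |g (.inr k)|) (fun k _ => abs_nonneg _) hl
  refine ⟨fun i => g (.inl i), fun l => g (.inr l) + ∑ k ∈ V.Locs, |g (.inr k)|,
    fun i => ?_, fun l hl => ?_, fun s hs => ?_, ?_⟩
  · have : (0 : ℚ) ≤ g (.inl i) := by rw [hgr]; exact mul_nonneg hN'.le (hr i)
    exact_mod_cast this
  · linarith [hle hl, neg_abs_le (g (.inr l))]
  · have h₀ := mul_nonpos_of_nonneg_of_nonpos hN'.le (hrow s hs)
    rw [← hval hs] at h₀
    have h₁ : (∑ i, s.2.1 i * g (.inl i)) + g (.inr s.1) - g (.inr s.2.2) ≤ 0 := by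
      exact_mod_cast h₀
    linarith
  · have h₀ := mul_neg_of_pos_of_neg hN' hstrict
    rw [← hval ht] at h₀
    have h₁ : (∑ i, t.2.1 i * g (.inl i)) + g (.inr t.1) - g (.inr t.2.2) < 0 := by
      exact_mod_cast h₀
    linarith

/-- A rational solution of (A_t) yields an integer one. -/
theorem satA_of_rat [DecidableEq L] {V : VASS n L} {t : Transition n L} (ht : t ∈ V.Trns)
    (μ : Transition n L → ℚ) (hD : ∀ i, 0 ≤ ∑ s ∈ V.Trns, (s.2.1 i : ℚ) * μ s)
    (hμ : ∀ s ∈ V.Trns, 0 ≤ μ s)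
    (hF : ∀ l ∈ V.Locs, ∑ s ∈ V.Trns,
      ((if s.1 = l then (1 : ℚ) else 0) - (if s.2.2 = l then 1 else 0)) * μ s = 0)
    (hμt : 0 < μ t) : SatA V t := by
  obtain ⟨N, hN, g, hg⟩ := exists_common_denominator V.Trns μ
  have hN' : (0 : ℚ) < N := by exact_mod_cast hN
  have hsum (a : Transition n L → ℤ) :
      ((∑ s ∈ V.Trns, a s * g s : ℤ) : ℚ) = N * ∑ s ∈ V.Trns, (a s : ℚ) * μ s := by
    push_cast
    rw [Finset.mul_sum]
    exact Finset.sum_congr rfl fun s hs => by rw [hg s hs]; ring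
  refine ⟨g, ⟨fun i => ?_, fun s hs => ?_, fun l hl => ?_⟩, ?_⟩
  · have h₀ := mul_nonneg hN'.le (hD i)
    rw [← hsum fun s => s.2.1 i] at h₀
    exact_mod_cast h₀
  · have h₀ := mul_nonneg hN'.le (hμ s hs)
    rw [← hg s hs] at h₀
    exact_mod_cast h₀
  · have h₀ := hsum fun s => (if s.1 = l then 1 else 0) - (if s.2.2 = l then 1 else 0)
    have h₁ := hF l hl
    push_cast at h₀
    rw [h₁, mul_zero] at h₀
    exact_mod_cast h₀
  · have h₀ := mul_pos hN' hμt
    rw [← hg t ht] at h₀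
    exact Int.add_one_le_iff.2 (by exact_mod_cast h₀)

/-- One of the systems (A_t) and (B_t) is solvable. -/
theorem satA_or_satB [DecidableEq L] {V : VASS n L} {t : Transition n L} (ht : t ∈ V.Trns) :
    SatA V t ∨ SatB V t := by
  refine or_iff_not_imp_right.2 fun hB => ?_
  let A : Transition n L ⊕ Fin n → ((Fin n → ℚ) × (L → ℚ)) →ₗ[ℚ] ℚ :=
    Sum.elim rowFunctional fun i => -(LinearMap.proj i ∘ₗ LinearMap.fst ℚ _ _)
  obtain ⟨c, hc, hbc⟩ := farkas (V.Trns.disjSum Finset.univ) A (-rowFunctional t) (by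
    intro x hx
    by_contra! hlt
    refine hB (satB_of_rat ht x (fun i => ?_) (fun s hs => ?_) (by simpa using hlt))
    · simpa [A] using hx (.inr i) (by simp)
    · simpa [A] using hx (.inl s) (by simpa using hs))
  have hcomb (x : (Fin n → ℚ) × (L → ℚ)) :
      ∑ s ∈ V.Trns, rowFunctional s x * (c (.inl s) + if s = t then 1 else 0) =
        ∑ i, c (.inr i) * x.1 i := by
    have h₀ := LinearMap.congr_fun hbc x
    simp only [Finset.sum_disjSum, LinearMap.neg_apply, LinearMap.add_apply, LinearMap.sum_apply,
      LinearMap.smul_apply, smul_eq_mul, A, Sum.elim_inl, Sum.elim_inr, LinearMap.comp_apply,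
      LinearMap.fst_apply, LinearMap.proj_apply, mul_neg, Finset.sum_neg_distrib] at h₀
    simp only [mul_add, Finset.sum_add_distrib, mul_ite, mul_one, mul_zero, Finset.sum_ite_eq', ht,
      if_true]
    simp only [mul_comm (rowFunctional _ x)]
    linarith
  refine satA_of_rat ht (fun s => c (.inl s) + if s = t then 1 else 0) (fun i => ?_)
    (fun s _ => ?_) (fun l _ => ?_) ?_
  · have h₀ := hcomb (Pi.single i 1, 0)
    simp only [rowFunctional_apply, Pi.single_apply, mul_ite, mul_one, mul_zero,
      Finset.sum_ite_eq', Finset.mem_univ, if_true, Pi.zero_apply, add_zero, sub_zero] at h₀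
    rw [h₀]
    exact hc _
  · have := hc (.inl s)
    positivity
  · have h₀ := hcomb (0, Pi.single l 1)
    simpa [rowFunctional_apply, Pi.single_apply] using h₀
  · have := hc (.inl t)
    simp only [if_true]
    linarith

/-- **Duality of the constraint systems (Farkas).** For every transition `t` of `V`,
exactly one of the constraint systems (A_t) and (B_t) has an integer solution. -/
theorem constraint_systems_duality {n : ℕ} {L : Type} [DecidableEq L]
    (V : VASS n L) (t : Transition n L) (ht : t ∈ V.Trns) :
    Xor' (SatA V t) (SatB V t) := by
  rcases satA_or_satB ht with hA | hB
  · exact Or.inl ⟨hA, hA.not_satB ht⟩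
  · exact Or.inr ⟨hB, fun hA => hA.not_satB ht hB⟩

end VASSPaper
end

section
/- Concatenation combinator for lexicographic ranking functions: Let V be a VASS and T ⊆ Trns(V) a subset of transitions such that V' = (Locs(V), Trns(V) \ T) can be fully decomposed into SCCs. Let q : States(V) → ℕ be a quasi-ranking function for V that is ranking for each transition in T, and for each SCC S of V' let rank_S : States(V) → ℕ^* be a lexicographic ranking function for S. Then the function f defined by f(l,v) = ⟨q(l,v)⟩ ⊕ rank_S(l,v), where S is the SCC of V' containing l, is a lexicographic ranking function for V. -/
namespace VASSPaper

variable {n : ℕ} {L : Type}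

/-- The union of two VASSs. -/
def unionVASS [DecidableEq L] (A B : VASS n L) : VASS n L where
  Locs := A.Locs ∪ B.Locs
  Trns := A.Trns ∪ B.Trns
  valid := by
    intro t ht
    rcases Finset.mem_union.1 ht with h | h
    · exact ⟨Finset.mem_union_left _ (A.valid t h).1, Finset.mem_union_left _ (A.valid t h).2⟩
    · exact ⟨Finset.mem_union_right _ (B.valid t h).1, Finset.mem_union_right _ (B.valid t h).2⟩

theorem Reaches.mono {A B : VASS n L} (h : A.Trns ⊆ B.Trns) {l l' : L} (hr : Reaches A l l') :
    Reaches B l l' :=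
  Relation.ReflTransGen.mono (fun _ _ ⟨d, hd⟩ => ⟨d, h hd⟩) _ _ hr

theorem SubVASS.antisymm {A B : VASS n L} (h : SubVASS A B) (h' : SubVASS B A) : A = B := by
  have hL := h.1.antisymm h'.1
  have hT := h.2.antisymm h'.2
  cases A
  cases B
  subst hL hT
  rfl

/-- The union of two connected VASSs with a common location is connected. -/
theorem ConnectedV.unionVASS [DecidableEq L] {A B : VASS n L} (hA : ConnectedV A)
    (hB : ConnectedV B) {l : L} (hlA : l ∈ A.Locs) (hlB : l ∈ B.Locs) :
    ConnectedV (unionVASS A B) := by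
  have mA {a b : L} (h : Reaches A a b) : Reaches (VASSPaper.unionVASS A B) a b :=
    h.mono Finset.subset_union_left
  have mB {a b : L} (h : Reaches B a b) : Reaches (VASSPaper.unionVASS A B) a b :=
    h.mono Finset.subset_union_right
  intro a ha b hb
  have h₁ : Reaches (VASSPaper.unionVASS A B) a l := by
    rcases Finset.mem_union.1 ha with h | h
    · exact mA (hA a h l hlA)
    · exact mB (hB a h l hlB)
  have h₂ : Reaches (VASSPaper.unionVASS A B) l b := by
    rcases Finset.mem_union.1 hb with h | h
    · exact mA (hA l hlA b h)
    · exact mB (hB l hlB b h)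
  exact Relation.ReflTransGen.trans h₁ h₂

/-- Two strongly connected components with a common location coincide. -/
theorem IsSCC.eq_of_mem [DecidableEq L] {V A B : VASS n L} (hA : IsSCC V A) (hB : IsSCC V B)
    {l : L} (hlA : l ∈ A.Locs) (hlB : l ∈ B.Locs) : A = B := by
  have hU : SubVASS (unionVASS A B) V :=
    ⟨Finset.union_subset hA.1.1 hB.1.1, Finset.union_subset hA.1.2 hB.1.2⟩
  have hc := hA.2.1.unionVASS hB.2.1 hlA hlB
  have iA : SubVASS A (unionVASS A B) := ⟨Finset.subset_union_left, Finset.subset_union_left⟩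
  have iB : SubVASS B (unionVASS A B) := ⟨Finset.subset_union_right, Finset.subset_union_right⟩
  exact (iA.antisymm (hA.2.2 _ hU hc iA)).trans (iB.antisymm (hB.2.2 _ hU hc iB)).symm

theorem LexGt.cons_of_lt {a b : ℕ} (h : b < a) (x y : List ℕ) : LexGt (a :: x) (b :: y) :=
  ⟨0, by simp, by simp, by simpa using h, by simp⟩

theorem LexGt.cons {x y : List ℕ} (h : LexGt x y) (a : ℕ) : LexGt (a :: x) (a :: y) := by
  obtain ⟨i, hx, hy, hlt, heq⟩ := h
  refine ⟨i + 1, by simpa using hx, by simpa using hy, by simpa using hlt, ?_⟩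
  rintro (_ | j) hj
  · simp
  · simpa using heq j (by omega)

/-- **Concatenation combinator for lexicographic ranking functions.** Let `T` be a set
of transitions such that `V' = (Locs(V), Trns(V) \ T)` can be fully decomposed into
SCCs, let `q` be a quasi-ranking function for `V` ranking for each transition in `T`,
and for each SCC `S` of `V'` let `rk S` be a lexicographic ranking function for `S`.
Then `(l,v) ↦ ⟨q(l,v)⟩ ⊕ rk (SCC of l) (l,v)` is a lexicographic ranking function
for `V`. -/
theorem concatenation_combinator {n : ℕ} {L : Type} [DecidableEq L]
    (V V' : VASS n L) (T : Finset (Transition n L)) (hT : ↑T ⊆ V.Trns)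
    (hV'L : V'.Locs = V.Locs) (hV'T : V'.Trns = V.Trns \ T)
    (hdec : FullyDecomposable V')
    (q : L × Val n → ℕ) (hq : QuasiRanking V q) (hqT : ∀ t ∈ T, RankingFor V q t)
    (sccOf : L → VASS n L)
    (hscc : ∀ l ∈ V.Locs, IsSCC V' (sccOf l) ∧ l ∈ (sccOf l).Locs)
    (rk : VASS n L → (L × Val n → List ℕ))
    (hrk : ∀ S, IsSCC V' S → ∃ k, IsLexRankingOfOrder S k (rk S)) :
    ∃ k, IsLexRankingOfOrder V k (fun s => q s :: rk (sccOf s.1) s) := by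
  choose! k hk using hrk
  refine ⟨(V.Locs.sup fun l => k (sccOf l)) + 1, ?_, ?_⟩
  · intro s hs
    obtain ⟨hS, hmem⟩ := hscc s.1 hs
    have h₁ := (hk _ hS).1 s hmem
    have h₂ := Finset.le_sup (f := fun l => k (sccOf l)) hs
    simp only [List.length_cons] at h₂ ⊢
    omega
  · intro s d s' hstep
    have hval := V.valid _ hstep.1
    rcases (hq s d s' hstep).lt_or_eq with hlt | heq
    · exact LexGt.cons_of_lt hlt _ _
    have hnT : (s.1, d, s'.1) ∉ T := fun hmem =>
      (hqT _ hmem s d s' hstep rfl).ne heq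
    have ht : (s.1, d, s'.1) ∈ V'.Trns := by
      rw [hV'T]
      exact Finset.mem_sdiff.2 ⟨hstep.1, hnT⟩
    obtain ⟨S, hS, htS⟩ := hdec _ ht
    have hvS := S.valid _ htS
    obtain ⟨h₁, m₁⟩ := hscc s.1 hval.1
    obtain ⟨h₂, m₂⟩ := hscc s'.1 hval.2
    have e₁ : sccOf s.1 = S := h₁.eq_of_mem hS m₁ hvS.1
    have e₂ : sccOf s'.1 = S := h₂.eq_of_mem hS m₂ hvS.2
    simp only [e₁, e₂, heq]
    exact ((hk S hS).2 s d s' ⟨htS, hstep.2⟩).cons _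

end VASSPaper
end

section
/- Dimension decrease under removal of ranked transitions: Let V be a VASS of dimension n and let T be the set of all transitions t ∈ Trns(V) for which constraint system (B_t) is satisfiable (i.e., there exist r ∈ ℤ^n, z ∈ ℤ^{Locs(V)} with r ≥ 0, z ≥ 0 and D^T r + F^T z ≤ 0 with strict inequality in row t). If T ≠ ∅, then for every SCC S of V' = (Locs(V), Trns(V) \ T) we have dim(cone(S)) < dim(cone(V)). -/
namespace VASSPaper

variable {n : ℕ} {L : Type}

/-- Summation by parts: pairing a potential on the locations with the incidence
matrix amounts to summing its differences along the transitions. -/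
theorem sum_potential_mul_incidence [DecidableEq L] (V : VASS n L) (z : L → ℚ)
    (μ : Transition n L → ℚ) :
    ∑ l ∈ V.Locs, z l *
      ∑ t ∈ V.Trns, ((if t.1 = l then (1 : ℚ) else 0) - (if t.2.2 = l then 1 else 0)) * μ t =
    ∑ t ∈ V.Trns, (z t.1 - z t.2.2) * μ t := by
  simp_rw [Finset.mul_sum]
  rw [Finset.sum_comm]
  refine Finset.sum_congr rfl fun t ht => ?_
  obtain ⟨h₁, h₂⟩ := V.valid t ht
  simp_rw [← mul_assoc, ← Finset.sum_mul, mul_sub, Finset.sum_sub_distrib, mul_ite, mul_one,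
    mul_zero, Finset.sum_ite_eq, if_pos h₁, if_pos h₂]

/-- Along a circulation, potentials do not change the value of a linear functional. -/
theorem sum_functional_eq_sum_reduced [DecidableEq L] (V : VASS n L) (r : Fin n → ℚ) (z : L → ℚ)
    (μ : Transition n L → ℚ)
    (hF : ∀ l ∈ V.Locs,
      ∑ t ∈ V.Trns, ((if t.1 = l then (1 : ℚ) else 0) - (if t.2.2 = l then 1 else 0)) * μ t = 0) :
    ∑ i, r i * ∑ t ∈ V.Trns, (t.2.1 i : ℚ) * μ t =
      ∑ t ∈ V.Trns, ((∑ i, (t.2.1 i : ℚ) * r i) + z t.1 - z t.2.2) * μ t := by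
  have hz : ∑ t ∈ V.Trns, (z t.1 - z t.2.2) * μ t = 0 := by
    rw [← sum_potential_mul_incidence]
    exact Finset.sum_eq_zero fun l hl => by rw [hF l hl, mul_zero]
  simp_rw [add_sub_assoc, add_mul, Finset.sum_add_distrib]
  rw [hz, add_zero]
  simp_rw [Finset.mul_sum]
  rw [Finset.sum_comm]
  refine Finset.sum_congr rfl fun t _ => ?_
  rw [Finset.sum_mul]
  exact Finset.sum_congr rfl fun i _ => by ring

/-- A transition of the system carries a unit flow from its source to its target. -/
theorem sum_incidence_single [DecidableEq L] (V : VASS n L) {t₀ : Transition n L}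
    (ht₀ : t₀ ∈ V.Trns) (l : L) :
    ∑ t ∈ V.Trns, ((if t.1 = l then (1 : ℚ) else 0) - (if t.2.2 = l then 1 else 0)) *
        (if t = t₀ then 1 else 0) =
      (if t₀.1 = l then (1 : ℚ) else 0) - (if t₀.2.2 = l then 1 else 0) := by
  simp_rw [mul_ite, mul_one, mul_zero, Finset.sum_ite_eq', if_pos ht₀]

/-- If `b` is reachable from `a`, there is a nonnegative unit flow from `a` to `b`. -/
theorem Reaches.exists_flow [DecidableEq L] {V : VASS n L} {a b : L} (h : Reaches V a b) :
    ∃ μ : Transition n L → ℚ, (∀ t, 0 ≤ μ t) ∧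
      ∀ l, ∑ t ∈ V.Trns,
          ((if t.1 = l then (1 : ℚ) else 0) - (if t.2.2 = l then 1 else 0)) * μ t =
        (if a = l then (1 : ℚ) else 0) - (if b = l then 1 else 0) := by
  induction h with
  | refl => exact ⟨fun _ => 0, fun _ => le_rfl, fun l => by simp⟩
  | @tail b c _ hbc ih =>
    obtain ⟨μ, hμ, hF⟩ := ih
    obtain ⟨d, hd⟩ := hbc
    refine ⟨fun t => μ t + if t = (b, d, c) then 1 else 0,
      fun t => add_nonneg (hμ t) (by split_ifs <;> simp), fun l => ?_⟩
    simp_rw [mul_add, Finset.sum_add_distrib]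
    rw [hF l, sum_incidence_single V hd]
    ring

/-- In a connected system every transition lies in the support of a circulation. -/
theorem ConnectedV.exists_circulation [DecidableEq L] {V : VASS n L} (hV : ConnectedV V)
    {t₀ : Transition n L} (ht₀ : t₀ ∈ V.Trns) :
    ∃ μ : Transition n L → ℚ, (∀ t, 0 ≤ μ t) ∧ 0 < μ t₀ ∧
      ∀ l, ∑ t ∈ V.Trns,
        ((if t.1 = l then (1 : ℚ) else 0) - (if t.2.2 = l then 1 else 0)) * μ t = 0 := by
  obtain ⟨h₁, h₂⟩ := V.valid t₀ ht₀
  obtain ⟨μ, hμ, hF⟩ := (hV _ h₂ _ h₁).exists_flow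
  refine ⟨fun t => μ t + if t = t₀ then 1 else 0,
    fun t => add_nonneg (hμ t) (by split_ifs <;> simp),
    add_pos_of_nonneg_of_pos (hμ t₀) (by simp), fun l => ?_⟩
  simp_rw [mul_add, Finset.sum_add_distrib]
  rw [hF l, sum_incidence_single V ht₀]
  ring

/-- The cone is monotone in the system: circulations extend by zero. -/
theorem coneSet_subset_of_trns_subset [DecidableEq L] {S V : VASS n L} (h : S.Trns ⊆ V.Trns) :
    coneSet S ⊆ coneSet V := by
  rintro x ⟨μ, hμ, hF, rfl⟩
  have hsum (f : Transition n L → ℚ) :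
      ∑ t ∈ V.Trns, f t * (if t ∈ S.Trns then μ t else 0) = ∑ t ∈ S.Trns, f t * μ t := by
    rw [← Finset.sum_subset h fun t _ ht => by rw [if_neg ht, mul_zero]]
    exact Finset.sum_congr rfl fun t ht => by rw [if_pos ht]
  refine ⟨fun t => if t ∈ S.Trns then μ t else 0, fun t _ => ?_, fun l _ => ?_, ?_⟩
  · dsimp only
    split_ifs with ht
    exacts [hμ t ht, le_rfl]
  · rw [hsum]
    by_cases hl : l ∈ S.Locs
    · exact hF l hl
    · refine Finset.sum_eq_zero fun t ht => ?_
      obtain ⟨h₁, h₂⟩ := S.valid t ht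
      rw [if_neg (ne_of_mem_of_not_mem h₁ hl), if_neg (ne_of_mem_of_not_mem h₂ hl), sub_zero,
        zero_mul]
  · funext i
    exact (hsum fun t => (t.2.1 i : ℚ)).symm

/-- **Dimension decrease under removal of ranked transitions.** Let `T` be the set of
transitions for which (B_t) is satisfiable. If `T` is non-empty, then for every SCC
`S` of `V' = (Locs(V), Trns(V) \ T)` the dimension of the cone of `S` is strictly
smaller than the dimension of the cone of `V`. -/
theorem cone_dimension_decrease {n : ℕ} {L : Type} [DecidableEq L]
    (V V' : VASS n L) (hconn : ConnectedV V) (T : Finset (Transition n L))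
    (hTmem : ∀ t, t ∈ T ↔ t ∈ V.Trns ∧ SatB V t) (hTne : T.Nonempty)
    (hV'L : V'.Locs = V.Locs) (hV'T : V'.Trns = V.Trns \ T)
    (S : VASS n L) (hS : IsSCC V' S) :
    coneDim S < coneDim V := by
  obtain ⟨t₀, ht₀⟩ := hTne
  obtain ⟨ht₀V, r, z, hr, hz, hle, hlt⟩ := (hTmem t₀).1 ht₀
  have hSV' : S.Trns ⊆ V.Trns \ T := hV'T ▸ hS.1.2
  have hSV : S.Trns ⊆ V.Trns := hSV'.trans Finset.sdiff_subset
  have hcast (t : Transition n L) :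
      (∑ i, (t.2.1 i : ℚ) * (r i : ℚ)) + (z t.1 : ℚ) - (z t.2.2 : ℚ) =
        (((∑ i, t.2.1 i * r i) + z t.1 - z t.2.2 : ℤ) : ℚ) := by
    push_cast
    rfl
  let φ : (Fin n → ℚ) →ₗ[ℚ] ℚ := ∑ i, (r i : ℚ) • LinearMap.proj i
  have hφ (x : Fin n → ℚ) : φ x = ∑ i, (r i : ℚ) * x i := by simp [φ]
  have hker : Submodule.span ℚ (coneSet S) ≤ LinearMap.ker φ := by
    refine Submodule.span_le.2 ?_
    rintro x ⟨μ, -, hF, rfl⟩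
    rw [SetLike.mem_coe, LinearMap.mem_ker, hφ,
      sum_functional_eq_sum_reduced S (fun i => (r i : ℚ)) (fun l => (z l : ℚ)) μ hF]
    refine Finset.sum_eq_zero fun t ht => ?_
    have htV := hSV ht
    have htT : t ∉ T := (Finset.mem_sdiff.1 (hSV' ht)).2
    have heq : (∑ i, t.2.1 i * r i) + z t.1 - z t.2.2 = 0 :=
      (hle t htV).antisymm <| not_lt.1 fun hneg =>
        htT ((hTmem t).2 ⟨htV, r, z, hr, hz, hle, hneg⟩)
    rw [hcast, heq, Int.cast_zero, zero_mul]
  obtain ⟨μ, hμ, hμ₀, hF⟩ := hconn.exists_circulation ht₀V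
  have hx : (fun i => ∑ t ∈ V.Trns, (t.2.1 i : ℚ) * μ t) ∈ coneSet V :=
    ⟨μ, fun t _ => hμ t, fun l _ => hF l, rfl⟩
  have hneg : φ (fun i => ∑ t ∈ V.Trns, (t.2.1 i : ℚ) * μ t) < 0 := by
    rw [hφ, sum_functional_eq_sum_reduced V (fun i => (r i : ℚ)) (fun l => (z l : ℚ)) μ
      fun l _ => hF l]
    refine Finset.sum_neg' (fun t ht => ?_) ⟨t₀, ht₀V, ?_⟩
    · rw [hcast]
      exact mul_nonpos_of_nonpos_of_nonneg (by exact_mod_cast hle t ht) (hμ t)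
    · rw [hcast]
      exact mul_neg_of_neg_of_pos (by exact_mod_cast hlt) hμ₀
  refine Submodule.finrank_lt_finrank_of_lt (lt_of_le_of_ne
    (Submodule.span_mono (coneSet_subset_of_trns_subset hSV)) fun heq => hneg.ne ?_)
  exact LinearMap.mem_ker.1 (hker (heq ▸ Submodule.subset_span hx))

end VASSPaper
end

section
/- Polynomial upper bound for conservative VASSs with affine lexicographic ranking functions: Let V be a conservative VASS of dimension n that admits a lexicographic ranking function rank = rank_1 ⊕ ⋯ ⊕ rank_k of order k in which each component has the affine form rank_i(l,v) = r_i^T v + z_i(l) for some r_i ∈ ℕ^n and z_i ∈ ℕ^{Locs(V)}. Then V is terminating and comp_N(V) ∈ O(N^k), i.e., there is a constant C such that comp_N(V) ≤ C·N^k for all sufficiently large N. -/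
namespace VASSPaper

variable {n : ℕ} {L : Type}

/-- The tuple of values at `s` of affine functions with coefficients `r` and offsets `z`. -/
def affineRank {k : ℕ} (r : Fin k → Fin n → ℕ) (z : Fin k → L → ℕ) (s : L × Val n) :
    Fin k → ℕ :=
  fun i => (∑ j, r i j * s.2 j) + z i s.1

theorem toLex_lt_of_lexGt_ofFn {k : ℕ} {x y : Fin k → ℕ}
    (h : LexGt (List.ofFn x) (List.ofFn y)) : toLex y < toLex x := by
  obtain ⟨i, hi, -, hlt, heq⟩ := h
  have hik : i < k := by simpa using hi
  refine ⟨⟨i, hik⟩, fun j hj => ?_, ?_⟩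
  · have := heq j hj
    simp [List.getD_eq_getElem?_getD] at this
    exact this.symm
  · simpa [List.getD_eq_getElem?_getD, hik] using hlt

theorem Step.target_mem {V : VASS n L} {s s' : L × Val n} {d : Upd n} (h : Step V s d s') :
    s'.1 ∈ V.Locs :=
  (V.valid _ h.1).2

theorem Step.sum_eq {V : VASS n L} (hcons : Conservative V) {s s' : L × Val n} {d : Upd n}
    (h : Step V s d s') : ∑ i, s'.2 i = ∑ i, s.2 i := by
  have hd : ∑ i, d i = 0 := hcons _ h.1
  zify
  simp [h.2, Finset.sum_add_distrib, hd]

/-- Along a trace of a conservative VASS, the locations stay in `V` and the total is preserved. -/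
theorem FinTrace.mem_locs_and_sum_eq {V : VASS n L} (hcons : Conservative V) {m : ℕ} {ℓ : ℕ → L}
    {v : ℕ → Val n} {d : ℕ → Upd n} (h : FinTrace V m ℓ v d) (h0 : ℓ 0 ∈ V.Locs) {i : ℕ}
    (hi : i ≤ m) : ℓ i ∈ V.Locs ∧ ∑ j, v i j = ∑ j, v 0 j := by
  induction i with
  | zero => exact ⟨h0, rfl⟩
  | succ i ih =>
    exact ⟨(h i hi).target_mem, ((h i hi).sum_eq hcons).trans (ih (by omega)).2⟩

/-- A strictly lexicographically decreasing chain of tuples with entries at most `M` has at most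
`(M + 1) ^ k` members. -/
theorem length_lt_of_lex_decreasing {k m M : ℕ} (f : ℕ → Fin k → ℕ)
    (hdec : ∀ i < m, toLex (f (i + 1)) < toLex (f i)) (hM : ∀ i ≤ m, ∀ a, f i a ≤ M) :
    m < (M + 1) ^ k := by
  have hanti : ∀ j ≤ m, ∀ i < j, toLex (f j) < toLex (f i) := by
    intro j
    induction j with
    | zero => intro _ i hi; omega
    | succ j ih =>
      intro hj i hi
      rcases Nat.lt_succ_iff_lt_or_eq.mp hi with hij | rfl
      · exact (hdec j hj).trans (ih (by omega) i hij)
      · exact hdec i hj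
  let g : Fin (m + 1) → Fin k → Fin (M + 1) :=
    fun i a => ⟨f i a, Nat.lt_succ_of_le (hM i (Nat.le_of_lt_succ i.2) a)⟩
  have hg : Function.Injective g := by
    intro i j hij
    have hf : f i = f j := funext fun a => congrArg Fin.val (congrFun hij a)
    rcases lt_trichotomy (i : ℕ) j with h | h | h
    · exact absurd (congrArg toLex hf.symm) (hanti j (Nat.le_of_lt_succ j.2) i h).ne
    · exact Fin.ext h
    · exact absurd (congrArg toLex hf) (hanti i (Nat.le_of_lt_succ i.2) j h).ne
  have := Fintype.card_le_of_injective g hg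
  simpa using this

theorem affineRank_le {k : ℕ} (V : VASS n L) (r : Fin k → Fin n → ℕ) (z : Fin k → L → ℕ)
    {s : L × Val n} (hs : s.1 ∈ V.Locs) (a : Fin k) :
    affineRank r z s a ≤
      (∑ i, ∑ j, r i j) * (∑ j, s.2 j) + ∑ i, ∑ l ∈ V.Locs, z i l := by
  have hr : ∀ j, r a j ≤ ∑ i, ∑ j, r i j := fun j =>
    (Finset.single_le_sum (f := fun j => r a j) (fun _ _ => Nat.zero_le _)
      (Finset.mem_univ j)).trans
    (Finset.single_le_sum (f := fun i => ∑ j, r i j) (fun _ _ => Nat.zero_le _)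
      (Finset.mem_univ a))
  have hz : z a s.1 ≤ ∑ i, ∑ l ∈ V.Locs, z i l :=
    (Finset.single_le_sum (f := fun l => z a l) (fun _ _ => Nat.zero_le _) hs).trans
    (Finset.single_le_sum (f := fun i => ∑ l ∈ V.Locs, z i l) (fun _ _ => Nat.zero_le _)
      (Finset.mem_univ a))
  refine Nat.add_le_add ?_ hz
  rw [Finset.mul_sum]
  exact Finset.sum_le_sum fun j _ => Nat.mul_le_mul_right _ (hr j)

/-- **Polynomial upper bound for conservative VASSs with affine lexicographic ranking
functions.** If a conservative VASS `V` admits a lexicographic ranking function of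
order `k` whose components are affine, `rank_i(l,v) = rᵢᵀv + zᵢ(l)`, then `V` is
terminating and `comp_N(V) ∈ O(N^k)`. -/
theorem conservative_polynomial_upper_bound {n : ℕ} {L : Type} (V : VASS n L)
    (hcons : Conservative V) (k : ℕ)
    (r : Fin k → Fin n → ℕ) (z : Fin k → L → ℕ)
    (hlex : ∀ s d s', Step V s d s' →
      LexGt (List.ofFn (fun i => (∑ j, r i j * s.2 j) + z i s.1))
            (List.ofFn (fun i => (∑ j, r i j * s'.2 j) + z i s'.1))) :
    Terminating V ∧ ∃ C N₀ : ℕ, ∀ N, N₀ ≤ N → compN V N ≤ C * N ^ k := by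
  have hdec : ∀ s d s', Step V s d s' →
      toLex (affineRank r z s') < toLex (affineRank r z s) :=
    fun s d s' h => toLex_lt_of_lexGt_ofFn (hlex s d s' h)
  constructor
  · rintro ⟨ℓ, v, d, h⟩
    exact not_strictAnti_of_wellFoundedLT (fun i => toLex (affineRank r z (ℓ i, v i)))
      (strictAnti_nat_of_succ_lt fun i => hdec _ _ _ (h i))
  · set R := ∑ i, ∑ j, r i j
    set Z := ∑ i, ∑ l ∈ V.Locs, z i l
    refine ⟨(R * n + Z + 1) ^ k, 1, fun N hN => csSup_le' ?_⟩
    rintro m ⟨ℓ, v, d, ⟨h0, hv⟩, h⟩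
    have hsum : ∑ j, v 0 j ≤ n * N := by
      simpa using Finset.sum_le_card_nsmul Finset.univ (v 0) N fun j _ => hv j
    have hm : m < (R * (n * N) + Z + 1) ^ k := by
      refine length_lt_of_lex_decreasing (fun i => affineRank r z (ℓ i, v i))
        (fun i hi => hdec _ _ _ (h i hi)) fun i hi a => ?_
      obtain ⟨hl, hs⟩ := h.mem_locs_and_sum_eq hcons h0 hi
      refine (affineRank_le V r z (s := (ℓ i, v i)) hl a).trans ?_
      simp only [hs]
      gcongr
    rw [← mul_pow]
    refine hm.le.trans (Nat.pow_le_pow_left ?_ k)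
    nlinarith [Nat.mul_le_mul_left Z hN]

end VASSPaper
end
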